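/- arXiv:math/0702446 — 2 statements merged into one kernel-verified Lean document; each statement's English description precedes it below -/
import Mathlib

section
/- For every real x > −1 the integral ∫₀¹ t^x dμ(t) is finite, while ∫₀¹ t^{−1} dμ(t) = ∞. -/
open MeasureTheory Set

/-- The fixed point sequence. -/
noncomputable def fpSeq : ℕ → ℝ
  | 0 => 1
  | n + 1 => (-1 + Real.sqrt (1 + 4 * fpSeq n ^ 2)) / (2 * fpSeq n)

open Filter Topology

lemma fpSeq_pos (n : ℕ) : 0 < fpSeq n := by
  induction n with
  | zero => simp [fpSeq]
  | succ n ih =>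
    rw [fpSeq]
    have h : 1 < Real.sqrt (1 + 4 * fpSeq n ^ 2) := by
      rw [Real.lt_sqrt (by norm_num)]
      nlinarith [pow_pos ih 2]
    exact div_pos (by linarith) (by linarith)

lemma fpSeq_succ_mul (n : ℕ) : fpSeq (n + 1) * (1 / fpSeq n + fpSeq (n + 1)) = 1 := by
  have hp := fpSeq_pos n
  have hs : Real.sqrt (1 + 4 * fpSeq n ^ 2) ^ 2 = 1 + 4 * fpSeq n ^ 2 :=
    Real.sq_sqrt (by positivity)
  rw [fpSeq]
  field_simp
  linear_combination hs

lemma fpSeq_mul_sum (n : ℕ) : fpSeq n * ∑ j ∈ Finset.range (n + 1), fpSeq j = 1 := by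
  induction n with
  | zero => simp [fpSeq]
  | succ n ih =>
    have h : ∑ j ∈ Finset.range (n + 1), fpSeq j = 1 / fpSeq n :=
      eq_one_div_of_mul_eq_one_right ih
    rw [Finset.sum_range_succ, h, fpSeq_succ_mul]

lemma ae_prod_mem {μ : Measure ℝ} (hI : ∀ᵐ t ∂μ, t ∈ Ioo (0 : ℝ) 1) :
    ∀ᵐ z ∂μ.prod μ, z.1 ∈ Ioo (0 : ℝ) 1 ∧ z.2 ∈ Ioo (0 : ℝ) 1 :=
  (Measure.quasiMeasurePreserving_fst.ae hI).and (Measure.quasiMeasurePreserving_snd.ae hI)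

section Moments

variable {μ : Measure ℝ} [IsProbabilityMeasure μ]

lemma integrable_pow_of_ae_mem_Icc (hI : ∀ᵐ t ∂μ, t ∈ Icc (0 : ℝ) 1) (n : ℕ) :
    Integrable (fun t : ℝ => t ^ n) μ := by
  refine Integrable.of_bound (by fun_prop) 1 ?_
  filter_upwards [hI] with t ht
  rw [Real.norm_of_nonneg (pow_nonneg ht.1 n)]
  exact pow_le_one₀ ht.1 ht.2

/-- The fixed point measure has no atom at `1`. -/
lemma ae_ne_one (hI : ∀ᵐ t ∂μ, t ∈ Icc (0 : ℝ) 1)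
    (hmom : ∀ n : ℕ, ∫ t, t ^ n ∂μ = fpSeq n) : ∀ᵐ t ∂μ, t ≠ 1 := by
  have hle (n : ℕ) : μ.real {1} ≤ fpSeq n := by
    rw [← hmom n, ← integral_indicator_one (measurableSet_singleton (1 : ℝ))]
    refine integral_mono_ae ?_ (integrable_pow_of_ae_mem_Icc hI n) ?_
    · exact (integrable_const (1 : ℝ)).indicator (measurableSet_singleton 1)
    · filter_upwards [hI] with t ht
      by_cases h : t = 1
      · simp [h]
      · simpa [h] using pow_nonneg ht.1 n
  have hc : (0 : ℝ) ≤ μ.real {1} := measureReal_nonneg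
  have hsq (n : ℕ) : μ.real {1} * ((n + 1 : ℕ) * μ.real {1}) ≤ 1 := by
    refine le_trans ?_ (fpSeq_mul_sum n).le
    refine mul_le_mul (hle n) ?_ (by positivity) (fpSeq_pos n).le
    calc ((n + 1 : ℕ) : ℝ) * μ.real {1} = ∑ _j ∈ Finset.range (n + 1), μ.real {1} := by simp
      _ ≤ _ := Finset.sum_le_sum fun j _ => hle j
  have hz : μ.real {1} = 0 := by
    by_contra hne
    have hpos : 0 < μ.real {1} * μ.real {1} := by positivity
    obtain ⟨n, hn⟩ := exists_nat_gt (1 / (μ.real {1} * μ.real {1}))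
    rw [div_lt_iff₀ hpos] at hn
    have := hsq n
    push_cast at this
    nlinarith
  rw [measureReal_eq_zero_iff] at hz
  simpa [ae_iff] using hz

/-- The difference quotient of `u ↦ u * p (s * u)` between `t` and `1`. -/
noncomputable def dilationQuotient (p : ℝ → ℝ) (z : ℝ × ℝ) : ℝ :=
  (p z.1 - z.2 * p (z.1 * z.2)) / (1 - z.2)

lemma dilationQuotient_pow (n : ℕ) (s : ℝ) {t : ℝ} (ht : t ≠ 1) :
    dilationQuotient (· ^ n) (s, t) = s ^ n * ∑ j ∈ Finset.range (n + 1), t ^ j := by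
  have h1 : 1 - t ≠ 0 := sub_ne_zero.2 ht.symm
  rw [dilationQuotient, div_eq_iff h1, mul_assoc, geom_sum_mul_neg]
  ring

lemma integral_dilationQuotient_pow (hI : ∀ᵐ t ∂μ, t ∈ Ioo (0 : ℝ) 1)
    (hmom : ∀ n : ℕ, ∫ t, t ^ n ∂μ = fpSeq n) (n : ℕ) :
    Integrable (dilationQuotient (· ^ n)) (μ.prod μ) ∧
      ∫ z, dilationQuotient (· ^ n) z ∂μ.prod μ = 1 := by
  have hint := integrable_pow_of_ae_mem_Icc (hI.mono fun t ht => Ioo_subset_Icc_self ht)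
  have heq : dilationQuotient (· ^ n) =ᵐ[μ.prod μ]
      fun z => z.1 ^ n * ∑ j ∈ Finset.range (n + 1), z.2 ^ j := by
    filter_upwards [ae_prod_mem hI] with z hz using dilationQuotient_pow n z.1 hz.2.2.ne
  have hsum : Integrable (fun t : ℝ => ∑ j ∈ Finset.range (n + 1), t ^ j) μ :=
    integrable_finsetSum _ fun j _ => hint j
  refine ⟨((hint n).mul_prod hsum).congr heq.symm, ?_⟩
  rw [integral_congr_ae heq, integral_prod_mul (fun s : ℝ => s ^ n)
    (fun t : ℝ => ∑ j ∈ Finset.range (n + 1), t ^ j),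
    integral_finsetSum _ fun j _ => hint j]
  simp only [hmom]
  exact fpSeq_mul_sum n

lemma dilationQuotient_one_sub_pow (k : ℕ) (z : ℝ × ℝ) :
    dilationQuotient (fun s => (1 - s) ^ k) z =
      ∑ n ∈ Finset.range (k + 1), (-1 : ℝ) ^ n * k.choose n * dilationQuotient (· ^ n) z := by
  have h (s : ℝ) : (1 - s) ^ k =
      ∑ n ∈ Finset.range (k + 1), (-1 : ℝ) ^ n * k.choose n * s ^ n := by
    rw [sub_eq_neg_add, add_pow]
    refine Finset.sum_congr rfl fun n _ => ?_
    rw [neg_pow, one_pow]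
    ring
  simp only [dilationQuotient, h, Finset.mul_sum, ← Finset.sum_sub_distrib, Finset.sum_div]
  refine Finset.sum_congr rfl fun n _ => ?_
  ring

lemma integral_dilationQuotient_one_sub_pow (hI : ∀ᵐ t ∂μ, t ∈ Ioo (0 : ℝ) 1)
    (hmom : ∀ n : ℕ, ∫ t, t ^ n ∂μ = fpSeq n) (k : ℕ) :
    Integrable (dilationQuotient fun s => (1 - s) ^ k) (μ.prod μ) ∧
      ∫ z, dilationQuotient (fun s => (1 - s) ^ k) z ∂μ.prod μ = (0 : ℝ) ^ k := by
  have h := integral_dilationQuotient_pow hI hmom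
  have hfun := funext (dilationQuotient_one_sub_pow k)
  have hint (n : ℕ) : Integrable
      (fun z => (-1 : ℝ) ^ n * k.choose n * dilationQuotient (· ^ n) z) (μ.prod μ) :=
    (h n).1.const_mul _
  constructor
  · rw [hfun]
    exact integrable_finsetSum _ fun n _ => hint n
  · rw [hfun, integral_finsetSum _ fun n _ => hint n]
    simp only [integral_const_mul, (h _).2]
    have := add_pow (-1 : ℝ) 1 k
    simp only [one_pow, mul_one] at this ⊢
    rw [← this]
    norm_num

lemma abs_dilationQuotient_one_sub_pow_le (k : ℕ) {s t : ℝ} (hs : s ∈ Ioo (0 : ℝ) 1)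
    (ht : t ∈ Ioo (0 : ℝ) 1) :
    |dilationQuotient (fun s => (1 - s) ^ k) (s, t)| ≤ k + 1 := by
  obtain ⟨hs0, hs1⟩ := hs
  obtain ⟨ht0, ht1⟩ := ht
  have h1 : 0 < 1 - t := by linarith
  have hst : s * t ≤ 1 := by nlinarith
  have hst0 : 0 < s * t := by positivity
  have hv : (1 - s * t) ^ k ≤ 1 := pow_le_one₀ (by linarith) (by linarith)
  have hv0 : 0 ≤ (1 - s * t) ^ k := pow_nonneg (by linarith) k
  have hdiff : |(1 - s) ^ k - (1 - s * t) ^ k| ≤ k * (1 - t) := by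
    refine (abs_pow_sub_pow_le _ _ k).trans ?_
    have ha : |1 - s - (1 - s * t)| ≤ 1 - t := by
      rw [abs_le]
      constructor <;> nlinarith
    have hm : max |1 - s| |1 - s * t| ^ (k - 1) ≤ 1 := by
      refine pow_le_one₀ (by positivity) (max_le ?_ ?_) <;> rw [abs_le] <;>
        constructor <;> linarith
    calc _ ≤ (1 - t) * k * 1 := by gcongr
      _ = _ := by ring
  rw [dilationQuotient, abs_div, abs_of_pos h1, div_le_iff₀ h1]
  calc |(1 - s) ^ k - t * (1 - s * t) ^ k|
      = |((1 - s) ^ k - (1 - s * t) ^ k) + (1 - t) * (1 - s * t) ^ k| := by ring_nf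
    _ ≤ |(1 - s) ^ k - (1 - s * t) ^ k| + |(1 - t) * (1 - s * t) ^ k| := abs_add_le _ _
    _ ≤ k * (1 - t) + (1 - t) * 1 := by
        rw [abs_of_nonneg (mul_nonneg h1.le hv0)]
        gcongr
    _ = _ := by ring

lemma hasSum_inv_add {ε s : ℝ} (hε : 0 < ε) (hs : s ∈ Ioo (0 : ℝ) 1) :
    HasSum (fun k : ℕ => (1 + ε)⁻¹ ^ (k + 1) * (1 - s) ^ k) (s + ε)⁻¹ := by
  obtain ⟨hs0, hs1⟩ := hs
  have h0 : 0 ≤ (1 + ε)⁻¹ * (1 - s) := mul_nonneg (by positivity) (by linarith)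
  have h1 : (1 + ε)⁻¹ * (1 - s) < 1 := by
    rw [inv_mul_lt_iff₀ (by positivity)]
    linarith
  have h := (hasSum_geometric_of_lt_one h0 h1).mul_left (1 + ε)⁻¹
  have hlim : (1 + ε)⁻¹ * (1 - (1 + ε)⁻¹ * (1 - s))⁻¹ = (s + ε)⁻¹ := by
    have hne : 1 + ε ≠ 0 := by positivity
    rw [← mul_inv]
    congr 1
    field_simp
    ring
  rw [hlim] at h
  simpa only [mul_pow, pow_succ', mul_assoc] using h

lemma dilationQuotient_inv_add {ε s t : ℝ} (hε : 0 < ε) (hs : 0 < s)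
    (ht : t ∈ Ioo (0 : ℝ) 1) :
    dilationQuotient (fun s => (s + ε)⁻¹) (s, t) = ε / ((s + ε) * (s * t + ε)) := by
  obtain ⟨ht0, ht1⟩ := ht
  have h1 : 1 - t ≠ 0 := by linarith
  have h2 : s + ε ≠ 0 := by positivity
  have h3 : s * t + ε ≠ 0 := by positivity
  simp only [dilationQuotient]
  field_simp
  ring

/-- The moment identity `fpSeq_mul_sum`, tested against `s ↦ 1 / (s + ε)`. -/
lemma integral_resolvent_kernel (hI : ∀ᵐ t ∂μ, t ∈ Ioo (0 : ℝ) 1)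
    (hmom : ∀ n : ℕ, ∫ t, t ^ n ∂μ = fpSeq n) {ε : ℝ} (hε : 0 < ε) :
    ∫ z : ℝ × ℝ, ε / ((z.1 + ε) * (z.1 * z.2 + ε)) ∂μ.prod μ = (1 + ε)⁻¹ := by
  have hr0 : 0 < (1 + ε)⁻¹ := by positivity
  have hr1 : (1 + ε)⁻¹ < 1 := inv_lt_one_of_one_lt₀ (by linarith)
  have hK := integral_dilationQuotient_one_sub_pow hI hmom
  have hbound : Summable fun k : ℕ => (1 + ε)⁻¹ ^ (k + 1) * ((k : ℝ) + 1) := by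
    have h1 := summable_pow_mul_geometric_of_norm_lt_one 1
      (show ‖(1 + ε)⁻¹‖ < 1 by rwa [Real.norm_of_nonneg hr0.le])
    have h2 := (summable_nat_add_iff 1).2 h1
    refine h2.congr fun k => ?_
    push_cast
    ring
  have hsum := hasSum_integral_of_summable_integral_norm (μ := μ.prod μ)
    (F := fun (k : ℕ) z => (1 + ε)⁻¹ ^ (k + 1) * dilationQuotient (fun s => (1 - s) ^ k) z)
    (fun k => (hK k).1.const_mul _) (by
      refine Summable.of_nonneg_of_le (fun k => by positivity) (fun k => ?_) hbound
      have := norm_integral_le_of_norm_le_const (μ := μ.prod μ)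
        (f := fun z => ‖(1 + ε)⁻¹ ^ (k + 1) * dilationQuotient (fun s => (1 - s) ^ k) z‖)
        (C := (1 + ε)⁻¹ ^ (k + 1) * ((k : ℝ) + 1)) (by
          filter_upwards [ae_prod_mem hI] with z hz
          rw [norm_norm, norm_mul, Real.norm_of_nonneg (by positivity)]
          gcongr
          exact abs_dilationQuotient_one_sub_pow_le k hz.1 hz.2)
      simpa using (le_abs_self _).trans this)
  have hleft : HasSum (fun k : ℕ => ∫ z, (1 + ε)⁻¹ ^ (k + 1) *
      dilationQuotient (fun s => (1 - s) ^ k) z ∂μ.prod μ) (1 + ε)⁻¹ := by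
    simp only [integral_const_mul, (hK _).2]
    convert hasSum_single (f := fun k : ℕ => (1 + ε)⁻¹ ^ (k + 1) * (0 : ℝ) ^ k) 0
      (fun k hk => by simp [hk]) using 1
    simp
  rw [hleft.unique hsum]
  refine integral_congr_ae ?_
  filter_upwards [ae_prod_mem hI] with z hz
  obtain ⟨s, t⟩ := z
  obtain ⟨hs, ht⟩ := hz
  have hst : s * t ∈ Ioo (0 : ℝ) 1 :=
    ⟨mul_pos hs.1 ht.1, mul_lt_one_of_nonneg_of_lt_one_left hs.1.le hs.2 ht.2.le⟩
  have h := ((hasSum_inv_add hε hs).sub ((hasSum_inv_add hε hst).mul_left t)).div_const (1 - t)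
  dsimp only
  rw [← dilationQuotient_inv_add hε hs.1 ht, dilationQuotient]
  refine h.tsum_eq.symm.trans (tsum_congr fun k => ?_)
  simp only [dilationQuotient]
  ring

lemma measureReal_Iic_le (hI : ∀ᵐ t ∂μ, t ∈ Ioo (0 : ℝ) 1)
    (hmom : ∀ n : ℕ, ∫ t, t ^ n ∂μ = fpSeq n) {ε : ℝ} (hε : 0 < ε) :
    μ.real (Iic ε) ≤ 4 * ε := by
  have hId := integral_resolvent_kernel hI hmom hε
  have hint : Integrable (fun z : ℝ × ℝ => ε / ((z.1 + ε) * (z.1 * z.2 + ε))) (μ.prod μ) := by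
    by_contra h
    rw [integral_undef h] at hId
    have : 0 < (1 + ε)⁻¹ := by positivity
    linarith
  have hle : ∫ z : ℝ × ℝ, (Iic ε ×ˢ univ).indicator (fun _ => (4 * ε)⁻¹) z ∂μ.prod μ ≤
      ∫ z : ℝ × ℝ, ε / ((z.1 + ε) * (z.1 * z.2 + ε)) ∂μ.prod μ := by
    refine integral_mono_ae ((integrable_const _).indicator
      (measurableSet_Iic.prod MeasurableSet.univ)) hint ?_
    filter_upwards [ae_prod_mem hI] with z hz
    obtain ⟨s, t⟩ := z
    obtain ⟨⟨hs0, hs1⟩, ht0, ht1⟩ := hz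
    dsimp only at *
    by_cases h : s ≤ ε
    · rw [indicator_of_mem (by simpa using h), inv_eq_one_div, div_le_div_iff₀ (by positivity)
        (by positivity)]
      have h1 : s + ε ≤ 2 * ε := by linarith
      have h2 : s * t + ε ≤ 2 * ε := by nlinarith
      have := mul_le_mul h1 h2 (by positivity) (by positivity)
      nlinarith
    · rw [indicator_of_notMem (by simpa using h)]
      positivity
  rw [hId, integral_indicator (measurableSet_Iic.prod MeasurableSet.univ),
    setIntegral_const, measureReal_prod_prod] at hle
  have h1 : (1 + ε)⁻¹ ≤ 1 := inv_le_one_of_one_le₀ (by linarith)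
  simp only [probReal_univ, mul_one, smul_eq_mul] at hle
  have := hle.trans h1
  rwa [← div_eq_mul_inv, div_le_one (by positivity)] at this

lemma lintegral_rpow_lt_top (hI : ∀ᵐ t ∂μ, t ∈ Ioo (0 : ℝ) 1)
    (hmom : ∀ n : ℕ, ∫ t, t ^ n ∂μ = fpSeq n) {x : ℝ} (hx : -1 < x) :
    ∫⁻ t, ENNReal.ofReal (t ^ x) ∂μ < ⊤ := by
  rcases le_or_gt 0 x with hx0 | hx0
  · calc ∫⁻ t, ENNReal.ofReal (t ^ x) ∂μ ≤ ∫⁻ _, 1 ∂μ := by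
          refine lintegral_mono_ae ?_
          filter_upwards [hI] with t ht
          exact ENNReal.ofReal_le_one.2 (Real.rpow_le_one ht.1.le ht.2.le hx0)
      _ < ⊤ := by simp
  have hmeas (k : ℕ) : μ (Iic ((1 / 2 : ℝ) ^ k)) ≤ ENNReal.ofReal (4 * (1 / 2 : ℝ) ^ k) := by
    rw [← ofReal_measureReal]
    exact ENNReal.ofReal_le_ofReal (measureReal_Iic_le hI hmom (by positivity))
  have hq : (1 / 2 : ℝ) ^ (x + 1) < 1 :=
    Real.rpow_lt_one (by norm_num) (by norm_num) (by linarith)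
  calc ∫⁻ t, ENNReal.ofReal (t ^ x) ∂μ
      ≤ ∫⁻ t, ∑' k : ℕ, (Iic ((1 / 2 : ℝ) ^ k)).indicator
          (fun _ => ENNReal.ofReal (((1 / 2 : ℝ) ^ (k + 1)) ^ x)) t ∂μ := by
        refine lintegral_mono_ae ?_
        filter_upwards [hI] with t ht
        obtain ⟨k, hk1, hk2⟩ := exists_nat_pow_near_of_lt_one ht.1 ht.2.le
          (show (0 : ℝ) < 1 / 2 by norm_num) (by norm_num)
        refine le_trans ?_ (ENNReal.le_tsum k)
        rw [indicator_of_mem (mem_Iic.2 hk2)]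
        exact ENNReal.ofReal_le_ofReal
          (Real.rpow_le_rpow_of_nonpos (by positivity) hk1.le hx0.le)
    _ = ∑' k : ℕ, ENNReal.ofReal (((1 / 2 : ℝ) ^ (k + 1)) ^ x) * μ (Iic ((1 / 2 : ℝ) ^ k)) := by
        rw [lintegral_tsum fun k => (measurable_const.indicator measurableSet_Iic).aemeasurable]
        simp only [lintegral_indicator_const measurableSet_Iic]
    _ ≤ ∑' k : ℕ, ENNReal.ofReal (4 * (1 / 2 : ℝ) ^ x * ((1 / 2 : ℝ) ^ (x + 1)) ^ k) := by
        refine ENNReal.tsum_le_tsum fun k => ?_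
        refine (mul_le_mul_right (hmeas k) _).trans ?_
        rw [← ENNReal.ofReal_mul (by positivity)]
        refine ENNReal.ofReal_le_ofReal (le_of_eq ?_)
        rw [Real.rpow_add_one (by norm_num), mul_pow, ← Real.rpow_pow_comm (by norm_num),
          pow_succ]
        ring
    _ < ⊤ := by
        have hs := (summable_geometric_of_lt_one (by positivity) hq).mul_left
          (4 * (1 / 2 : ℝ) ^ x)
        rw [← ENNReal.ofReal_tsum_of_nonneg (fun k => by positivity) hs]
        exact ENNReal.ofReal_lt_top

lemma lintegral_rpow_neg_one_eq_top (hI : ∀ᵐ t ∂μ, t ∈ Ioo (0 : ℝ) 1)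
    (hmom : ∀ n : ℕ, ∫ t, t ^ n ∂μ = fpSeq n) :
    ∫⁻ t, ENNReal.ofReal (t ^ (-1 : ℝ)) ∂μ = ⊤ := by
  by_contra hne
  have hint : Integrable (fun t : ℝ => t⁻¹) μ := by
    refine (lintegral_ofReal_ne_top_iff_integrable (by fun_prop) ?_).1 ?_
    · filter_upwards [hI] with t ht
      simpa using ht.1.le
    · simpa only [Real.rpow_neg_one] using hne
  have hlim0 : Tendsto (fun n : ℕ => 1 / ((n : ℝ) + 1)) atTop (𝓝 0) :=
    tendsto_one_div_add_atTop_nhds_zero_nat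
  have hdom := tendsto_integral_of_dominated_convergence (μ := μ.prod μ)
    (F := fun (n : ℕ) (z : ℝ × ℝ) => (1 / ((n : ℝ) + 1)) /
      ((z.1 + 1 / ((n : ℝ) + 1)) * (z.1 * z.2 + 1 / ((n : ℝ) + 1))))
    (f := fun _ => 0) (fun z => z.1⁻¹)
    (fun n => Measurable.aestronglyMeasurable (by fun_prop)) (hint.comp_fst μ) (fun n => by
      filter_upwards [ae_prod_mem hI] with z hz
      obtain ⟨⟨hs0, hs1⟩, ht0, ht1⟩ := hz
      have hε : 0 < 1 / ((n : ℝ) + 1) := by positivity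
      generalize 1 / ((n : ℝ) + 1) = ε at hε
      rw [Real.norm_of_nonneg (by positivity), inv_eq_one_div,
        div_le_div_iff₀ (by positivity) hs0]
      have h2 : 0 < z.1 * z.2 := by positivity
      nlinarith [mul_pos hs0 h2, mul_pos hε h2, mul_pos hε hε])
    (by
      filter_upwards [ae_prod_mem hI] with z hz
      obtain ⟨⟨hs0, hs1⟩, ht0, ht1⟩ := hz
      have h := hlim0.div ((hlim0.const_add z.1).mul (hlim0.const_add (z.1 * z.2)))
        (by simp [hs0.ne', ht0.ne'])
      simpa [Pi.div_def] using h)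
  have hone : Tendsto (fun n : ℕ => (1 + 1 / ((n : ℝ) + 1))⁻¹) atTop (𝓝 1) := by
    simpa using (hlim0.const_add 1).inv₀ (by norm_num)
  have hval (n : ℕ) := integral_resolvent_kernel hI hmom (ε := 1 / ((n : ℝ) + 1)) (by positivity)
  simp only [hval, integral_zero] at hdom
  exact one_ne_zero (tendsto_nhds_unique hone hdom)

end Moments

theorem stmt_3 (μ : Measure ℝ) [IsProbabilityMeasure μ]
    (hsupp : μ (Set.Icc (0:ℝ) 1)ᶜ = 0) (h0 : μ {0} = 0)
    (hmom : ∀ n : ℕ, ∫ t in Set.Icc (0:ℝ) 1, t ^ n ∂μ = fpSeq n) :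
    (∀ x : ℝ, -1 < x →
        ∫⁻ t in Set.Icc (0:ℝ) 1, ENNReal.ofReal (t ^ x) ∂μ < ⊤) ∧
      ∫⁻ t in Set.Icc (0:ℝ) 1, ENNReal.ofReal (t ^ (-1 : ℝ)) ∂μ = ⊤ := by
  have hIcc : ∀ᵐ t ∂μ, t ∈ Icc (0 : ℝ) 1 := by
    rw [ae_iff]
    exact hsupp
  have hne0 : ∀ᵐ t ∂μ, t ≠ 0 := by simpa [ae_iff] using h0
  rw [Measure.restrict_eq_self_of_ae_mem hIcc] at hmom ⊢
  have hI : ∀ᵐ t ∂μ, t ∈ Ioo (0 : ℝ) 1 := by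
    filter_upwards [hIcc, hne0, ae_ne_one hIcc hmom] with t ht ht0 ht1
    exact ⟨lt_of_le_of_ne ht.1 ht0.symm, lt_of_le_of_ne ht.2 ht1⟩
  exact ⟨fun x hx => lintegral_rpow_lt_top hI hmom hx, lintegral_rpow_neg_one_eq_top hI hmom⟩
end

section
/- One has lim_{n→∞} (λ_{n+1}² − λ_n²) = 2 and lim_{n→∞} (λ_n² − 2n)/log n = −1/2. -/
open Filter

/-- The sequence `λ₀ = 0`, `λ_{n+1} = (λₙ + √(λₙ² + 4))/2`. -/
noncomputable def lamSeq : ℕ → ℝ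
  | 0 => 0
  | n + 1 => (lamSeq n + Real.sqrt (lamSeq n ^ 2 + 4)) / 2

open Asymptotics Finset

lemma lamSeq_nonneg (n : ℕ) : 0 ≤ lamSeq n := by
  induction n with
  | zero => simp [lamSeq]
  | succ n ih => rw [lamSeq]; positivity

lemma lamSeq_succ_pos (n : ℕ) : 0 < lamSeq (n + 1) := by
  have := lamSeq_nonneg n
  rw [lamSeq]
  positivity

lemma lamSeq_succ_sq (n : ℕ) : lamSeq (n + 1) ^ 2 = lamSeq n * lamSeq (n + 1) + 1 := by
  have h : Real.sqrt (lamSeq n ^ 2 + 4) ^ 2 = lamSeq n ^ 2 + 4 := Real.sq_sqrt (by positivity)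
  rw [lamSeq]
  linear_combination h / 4

lemma lamSeq_sq_sub_sq (n : ℕ) :
    lamSeq (n + 1) ^ 2 - lamSeq n ^ 2 = 2 - (lamSeq (n + 1) ^ 2)⁻¹ := by
  have hpos := lamSeq_succ_pos n
  have h : lamSeq n = lamSeq (n + 1) - (lamSeq (n + 1))⁻¹ := by
    field_simp
    linarith [lamSeq_succ_sq n]
  rw [h]
  field_simp
  ring

lemma nat_le_lamSeq_sq (n : ℕ) : (n : ℝ) ≤ lamSeq n ^ 2 := by
  induction n with
  | zero => simp [lamSeq]
  | succ n ih =>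
    have h1 : 1 ≤ lamSeq (n + 1) ^ 2 := by
      have := mul_nonneg (lamSeq_nonneg n) (lamSeq_succ_pos n).le
      linarith [lamSeq_succ_sq n]
    have := inv_le_one_of_one_le₀ h1
    push_cast
    linarith [lamSeq_sq_sub_sq n]

lemma tendsto_lamSeq_sq_sub_sq :
    Tendsto (fun n : ℕ => lamSeq (n + 1) ^ 2 - lamSeq n ^ 2) atTop (nhds 2) := by
  have h : Tendsto (fun n : ℕ => lamSeq (n + 1) ^ 2) atTop atTop :=
    (tendsto_atTop_mono nat_le_lamSeq_sq tendsto_natCast_atTop_atTop).comp (tendsto_add_atTop_nat 1)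
  simpa [lamSeq_sq_sub_sq] using h.inv_tendsto_atTop.const_sub 2

lemma lamSeq_sq_sub_two_mul (n : ℕ) :
    lamSeq n ^ 2 - 2 * n = -∑ i ∈ range n, (lamSeq (i + 1) ^ 2)⁻¹ := by
  have h := sum_range_sub (fun i => lamSeq i ^ 2) n
  simp only [lamSeq_sq_sub_sq, sum_sub_distrib, sum_const, card_range, nsmul_eq_mul] at h
  have h0 : lamSeq 0 ^ 2 = 0 := by simp [lamSeq]
  linarith

lemma tendsto_lamSeq_sq_div : Tendsto (fun n : ℕ => (n : ℝ)⁻¹ * lamSeq n ^ 2) atTop (nhds 2) := by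
  have h := tendsto_lamSeq_sq_sub_sq.cesaro
  simp only [sum_range_sub (fun i => lamSeq i ^ 2)] at h
  simpa [lamSeq] using h

lemma sum_range_inv_eq_harmonic (n : ℕ) :
    ∑ i ∈ range n, ((i : ℝ) + 1)⁻¹ = harmonic n := by
  simp [harmonic]

lemma tendsto_harmonic_div_log :
    Tendsto (fun n : ℕ => (harmonic n : ℝ) / Real.log n) atTop (nhds 1) := by
  have hlog : Tendsto (fun n : ℕ => Real.log n) atTop atTop :=
    Real.tendsto_log_atTop.comp tendsto_natCast_atTop_atTop
  have h := (Real.tendsto_harmonic_sub_log.div_atTop hlog).add_const 1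
  rw [zero_add] at h
  refine h.congr' ?_
  filter_upwards [hlog.eventually_gt_atTop 0] with n hn
  field_simp
  ring

lemma tendsto_harmonic_atTop : Tendsto (fun n : ℕ => (harmonic n : ℝ)) atTop atTop :=
  tendsto_atTop_mono log_add_one_le_harmonic
    (Real.tendsto_log_atTop.comp (tendsto_natCast_atTop_atTop.comp (tendsto_add_atTop_nat 1)))

lemma tendsto_sum_inv_lamSeq_sq_div_harmonic :
    Tendsto (fun n : ℕ => (∑ i ∈ range n, (lamSeq (i + 1) ^ 2)⁻¹) / (harmonic n : ℝ)) atTop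
      (nhds (1 / 2)) := by
  have hterm : (fun i : ℕ => (lamSeq (i + 1) ^ 2)⁻¹ - 1 / 2 * ((i : ℝ) + 1)⁻¹) =o[atTop]
      fun i : ℕ => ((i : ℝ) + 1)⁻¹ := by
    rw [isLittleO_iff_tendsto' (Eventually.of_forall fun i hi => absurd hi (by positivity))]
    have h := ((tendsto_lamSeq_sq_div.comp (tendsto_add_atTop_nat 1)).inv₀ two_ne_zero).sub_const
      (1 / 2)
    rw [show (2 : ℝ)⁻¹ - 1 / 2 = 0 by norm_num] at h
    refine h.congr fun i => ?_
    have := lamSeq_succ_pos i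
    simp only [Function.comp_apply]
    push_cast
    field_simp
  have hsum := hterm.sum_range (fun i => by positivity)
    (by simpa only [sum_range_inv_eq_harmonic] using tendsto_harmonic_atTop)
  simp only [sum_sub_distrib, ← mul_sum, sum_range_inv_eq_harmonic] at hsum
  have h := hsum.tendsto_div_nhds_zero.add_const (1 / 2)
  rw [zero_add] at h
  refine h.congr' ?_
  filter_upwards [tendsto_harmonic_atTop.eventually_gt_atTop 0] with n hn
  field_simp
  ring

theorem stmt_12 :
    Tendsto (fun n : ℕ => lamSeq (n + 1) ^ 2 - lamSeq n ^ 2) atTop (nhds 2) ∧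
    Tendsto (fun n : ℕ => (lamSeq n ^ 2 - 2 * n) / Real.log n) atTop
      (nhds (-(1 / 2))) := by
  refine ⟨tendsto_lamSeq_sq_sub_sq, ?_⟩
  have h := (tendsto_sum_inv_lamSeq_sq_div_harmonic.mul tendsto_harmonic_div_log).neg
  rw [mul_one] at h
  refine h.congr' ?_
  filter_upwards [tendsto_harmonic_atTop.eventually_gt_atTop 0] with n hn
  rw [lamSeq_sq_sub_two_mul, div_mul_div_cancel₀ hn.ne', neg_div]
end
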